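/- Let r ≥ 3 and let G be a graph that admits non-negative weights w_K on its copies of K_{2r+2} such that for every edge e of G, the total weight of copies of K_{2r+2} containing e lies in the interval [1 − 1/(2r+1), 1]. Then G has a fractional K_r-decomposition. -/

import Mathlib

open Finset
open scoped Classical

noncomputable def fracCliqueDecomp {V : Type*} [Fintype V] (G : SimpleGraph V) (r : ℕ) : Prop :=
  ∃ w : Finset V → ℝ, (∀ s, 0 ≤ w s) ∧
    ∀ u v : V, G.Adj u v →
      ∑ s ∈ univ.filter (fun s : Finset V => G.IsNClique r s ∧ u ∈ s ∧ v ∈ s), w s = 1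


lemma unif {α : Type*} [Fintype α] (P : Finset α) (j : ℕ) (hj : j ≤ #P) :
    ∃ μ : Finset α → ℝ, (∀ J, 0 ≤ μ J) ∧ (∀ J, μ J ≠ 0 → J ⊆ P ∧ #J = j) ∧
      (∑ J, μ J = 1) ∧
      (∀ u ∈ P, ∑ J, (if u ∈ J then μ J else 0) = (j : ℝ) / #P) ∧
      (∀ u ∈ P, ∀ v ∈ P, u ≠ v → ∑ J, (if u ∈ J ∧ v ∈ J then μ J else 0) =
        ((j : ℝ) * (j - 1)) / (#P * (#P - 1))) := by
  have hpos : (0 : ℝ) < (#P).choose j := by exact_mod_cast Nat.choose_pos hj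
  have key : ∀ A : Finset α, ∑ J, (if A ⊆ J then
      (if J ∈ P.powersetCard j then (1 : ℝ) / (#P).choose j else 0) else 0)
      = (#((P.powersetCard j).filter (A ⊆ ·)) : ℝ) / (#P).choose j := by
    intro A
    rw [← Finset.sum_filter, ← Finset.sum_filter]
    rw [Finset.sum_const, nsmul_eq_mul, mul_one_div]
    congr 3
    ext J
    simp [and_comm]
  refine ⟨fun J => if J ∈ P.powersetCard j then 1 / ((#P).choose j : ℝ) else 0, ?_, ?_, ?_, ?_, ?_⟩
  · intro J; dsimp only; split_ifs <;> positivity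
  · intro J h
    by_contra h'
    apply h
    simp only [mem_powersetCard]
    rw [if_neg h']
  · have := key ∅
    simp only [empty_subset, if_true, filter_true, card_powersetCard] at this
    rw [this, div_self hpos.ne']
  · intro u hu
    have h1 := key {u}
    simp only [singleton_subset_iff] at h1
    rw [h1]
    have hP : 0 < #P := card_pos.2 ⟨u, hu⟩
    have hP' : (0 : ℝ) < #P := by exact_mod_cast hP
    rw [div_eq_div_iff hpos.ne' hP'.ne']
    rcases Nat.eq_zero_or_pos j with rfl | hj0
    · have : (powersetCard 0 P).filter (u ∈ ·) = ∅ := by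
        ext J; simp +contextual
      rw [this]; simp
    · have h2 := card_filter_powersetCard_subset {u} P j (by simpa using hu) (by rw [card_singleton]; exact hj0)
      simp only [singleton_subset_iff, card_singleton] at h2
      rw [h2]
      obtain ⟨m, hm⟩ : ∃ m, #P = m + 1 := ⟨#P - 1, by omega⟩
      obtain ⟨i, rfl⟩ : ∃ i, j = i + 1 := ⟨j - 1, by omega⟩
      rw [hm]
      have := Nat.add_one_mul_choose_eq m i
      simp only [Nat.add_sub_cancel]
      have h3 : ((m + 1 : ℕ) : ℝ) * (m.choose i : ℝ) = ((m+1).choose (i+1) : ℝ) * ((i + 1 : ℕ) : ℝ) := by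
        exact_mod_cast this
      linarith
  · intro u hu v hv huv
    have h1 := key {u, v}
    simp only [insert_subset_iff, singleton_subset_iff] at h1
    rw [h1]
    have hsub : ({u, v} : Finset α) ⊆ P := by
      simp [insert_subset_iff, hu, hv]
    have hP : 2 ≤ #P := by
      rw [← card_pair huv]; exact card_le_card hsub
    have hP' : (2 : ℝ) ≤ #P := by exact_mod_cast hP
    have hne : (#P : ℝ) * (#P - 1) ≠ 0 := by
      apply mul_ne_zero <;> linarith
    rw [div_eq_div_iff hpos.ne' hne]
    by_cases hj0 : j < 2
    · have : (powersetCard j P).filter (fun J => u ∈ J ∧ v ∈ J) = ∅ := by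
        rw [filter_eq_empty_iff]
        intro J hJ h
        have : #({u, v} : Finset α) ≤ #J := card_le_card (by simp [insert_subset_iff, h])
        rw [card_pair huv, (mem_powersetCard.1 hJ).2] at this
        omega
      rw [this]
      interval_cases j <;> simp
    · have h2 := card_filter_powersetCard_subset {u, v} P j hsub (by rw [card_pair huv]; omega)
      simp only [insert_subset_iff, singleton_subset_iff, card_pair huv] at h2
      rw [h2]
      obtain ⟨m, hm⟩ : ∃ m, #P = m + 2 := ⟨#P - 2, by omega⟩
      obtain ⟨i, rfl⟩ : ∃ i, j = i + 2 := ⟨j - 2, by omega⟩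
      rw [hm]
      have e1 := Nat.add_one_mul_choose_eq m i
      have e2 := Nat.add_one_mul_choose_eq (m+1) (i+1)
      simp only [Nat.add_sub_cancel]
      have h3 : ((m + 1 : ℝ)) * (m.choose i : ℝ) = ((m+1).choose (i+1) : ℝ) * ((i + 1 : ℝ)) := by
        exact_mod_cast e1
      have h4 : ((m + 1 + 1: ℝ)) * ((m+1).choose (i+1) : ℝ) = ((m+2).choose (i+2) : ℝ) * ((i + 1 + 1 : ℝ)) := by
        exact_mod_cast e2
      push_cast
      linear_combination (m+2 : ℝ) * h3 + (i + 1 : ℝ) * h4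

lemma bits {ι : Type*} [Fintype ι] :
    ∃ c : ℝ, 0 ≤ c ∧ (∑ _b : ι → Bool, c = 1) ∧
      (∀ a x, ∑ b : ι → Bool, (if b a = x then c else 0) = 1 / 2) ∧
      (∀ a x a' x', a ≠ a' → ∑ b : ι → Bool, (if b a = x ∧ b a' = x' then c else 0) = 1 / 4) := by
  have h1 : ∑ _b : ι → Bool, (1 / 2 : ℝ) ^ Fintype.card ι = 1 := by
    simp
  have hc : (0 : ℝ) ≤ (1 / 2) ^ Fintype.card ι := by positivity
  generalize (1 / 2 : ℝ) ^ Fintype.card ι = c at h1 hc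
  have flip : ∀ (a : ι) (f : (ι → Bool) → ℝ),
      ∑ b, f b = ∑ b : ι → Bool, f (Function.update b a (!b a)) := by
    intro a f
    symm
    apply Finset.sum_nbij' (fun b => Function.update b a (!b a)) (fun b => Function.update b a (!b a))
    all_goals simp
  refine ⟨c, hc, h1, ?_, ?_⟩
  · intro a x
    have e := flip a (fun b => if b a = x then c else 0)
    have : ∑ b : ι → Bool, (if b a = x then c else 0) +
       ∑ b : ι → Bool, (if (Function.update b a (!b a)) a = x then c else 0) = 1 := by
      rw [← h1, ← Finset.sum_add_distrib]
      apply Finset.sum_congr rfl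
      intro b _
      cases h : b a <;> cases x <;> simp
    linarith
  · intro a x a' x' haa
    have hh : ∑ b : ι → Bool, (if b a' = x' then c else 0) = 1 / 2 := by
      have e := flip a' (fun b => if b a' = x' then c else 0)
      have : ∑ b : ι → Bool, (if b a' = x' then c else 0) +
         ∑ b : ι → Bool, (if (Function.update b a' (!b a')) a' = x' then c else 0) = 1 := by
        rw [← h1, ← Finset.sum_add_distrib]
        apply Finset.sum_congr rfl
        intro b _
        cases h : b a' <;> cases x' <;> simp
      linarith
    have e := flip a (fun b => if b a = x ∧ b a' = x' then c else 0)
    have : ∑ b : ι → Bool, (if b a = x ∧ b a' = x' then c else 0) +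
       ∑ b : ι → Bool, (if (Function.update b a (!b a)) a = x ∧ (Function.update b a (!b a)) a' = x' then c else 0) = 1/2 := by
      clear e
      rw [← hh, ← Finset.sum_add_distrib]
      apply Finset.sum_congr rfl
      intro b _
      rw [Function.update_of_ne (Ne.symm haa)]
      cases h : b a <;> cases x <;> simp
    linarith

def Dec {X : Type*} [Fintype X] (r : ℕ) (a : X → X → ℝ) : Prop :=
  ∃ x : Finset X → ℝ, (∀ S, 0 ≤ x S) ∧ (∀ S, x S ≠ 0 → #S = r) ∧
    ∀ u v, u ≠ v → ∑ S, (if u ∈ S ∧ v ∈ S then x S else 0) = a u v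

lemma dec_family {X I : Type*} [Fintype X] [Fintype I] (r : ℕ) (a : X → X → ℝ)
    (c : I → ℝ) (S : I → Finset X) (hc : ∀ i, 0 ≤ c i) (hS : ∀ i, c i ≠ 0 → #(S i) = r)
    (h : ∀ u v, u ≠ v → ∑ i, (if u ∈ S i ∧ v ∈ S i then c i else 0) = a u v) : Dec r a := by
  refine ⟨fun T => ∑ i, if S i = T then c i else 0, ?_, ?_, ?_⟩
  · intro T
    exact Finset.sum_nonneg fun i _ => by split_ifs; exacts [hc i, le_rfl]
  · intro T hT
    obtain ⟨i, _, hi⟩ := Finset.exists_ne_zero_of_sum_ne_zero hT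
    by_cases h' : S i = T
    · rw [if_pos h'] at hi; rw [← h']; exact hS i hi
    · rw [if_neg h'] at hi; exact absurd rfl hi
  · intro u v huv
    rw [← h u v huv]
    have : ∀ T : Finset X, (if u ∈ T ∧ v ∈ T then ∑ i, (if S i = T then c i else 0) else 0)
      = ∑ i, if S i = T then (if u ∈ S i ∧ v ∈ S i then c i else 0) else 0 := by
      intro T
      split_ifs with h1
      · apply Finset.sum_congr rfl
        intro i _
        split_ifs with h2 h3
        · rfl
        · subst h2; exact absurd h1 h3
        · rfl
      · symm
        apply Finset.sum_eq_zero
        intro i _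
        split_ifs with h2 h3
        · subst h2; exact absurd h3 h1
        · rfl
        · rfl
    simp_rw [this]
    rw [Finset.sum_comm]
    simp

lemma Dec.congr {X : Type*} [Fintype X] {r : ℕ} {a b : X → X → ℝ} (h : Dec r a)
    (hab : ∀ u v, u ≠ v → a u v = b u v) : Dec r b := by
  obtain ⟨x, h1, h2, h3⟩ := h
  exact ⟨x, h1, h2, fun u v huv => (h3 u v huv).trans (hab u v huv)⟩

lemma Dec.zero {X : Type*} [Fintype X] {r : ℕ} : Dec r (fun _ _ : X => 0) :=
  ⟨fun _ => 0, by simp, by simp, by simp⟩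

lemma Dec.add {X : Type*} [Fintype X] {r : ℕ} {a b : X → X → ℝ} (ha : Dec r a)
    (hb : Dec r b) : Dec r (fun u v => a u v + b u v) := by
  obtain ⟨x, h1, h2, h3⟩ := ha
  obtain ⟨y, g1, g2, g3⟩ := hb
  refine ⟨fun S => x S + y S, fun S => add_nonneg (h1 S) (g1 S), ?_, ?_⟩
  · intro S hS
    by_cases h : x S = 0
    · exact g2 S (by simpa [h] using hS)
    · exact h2 S h
  · intro u v huv
    dsimp only
    rw [← h3 u v huv, ← g3 u v huv, ← Finset.sum_add_distrib]
    apply Finset.sum_congr rfl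
    intro S _
    split_ifs <;> simp

lemma Dec.smul {X : Type*} [Fintype X] {r : ℕ} {a : X → X → ℝ} (c : ℝ) (hc : 0 ≤ c) (ha : Dec r a) :
    Dec r (fun u v => c * a u v) := by
  obtain ⟨x, h1, h2, h3⟩ := ha
  refine ⟨fun S => c * x S, fun S => mul_nonneg hc (h1 S), ?_, ?_⟩
  · intro S hS
    exact h2 S (right_ne_zero_of_mul hS)
  · intro u v huv
    dsimp only
    rw [← h3 u v huv, Finset.mul_sum]
    simp

lemma Dec.sum {X I : Type*} [Fintype X] {r : ℕ} (s : Finset I) (a : I → X → X → ℝ)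
    (h : ∀ i ∈ s, Dec r (a i)) : Dec r (fun u v => ∑ i ∈ s, a i u v) := by
  induction s using Finset.induction_on with
  | empty => simpa using Dec.zero
  | insert i s hi ih =>
    simp_rw [Finset.sum_insert hi]
    exact (h i (by simp)).add (ih fun k hk => h k (by simp [hk]))

lemma Dec.equiv {X Y : Type*} [Fintype X] [Fintype Y] {r : ℕ} {a : Y → Y → ℝ} (h : Dec r a)
    (σ : X ≃ Y) : Dec r (fun u v => a (σ u) (σ v)) := by
  obtain ⟨x, h1, h2, h3⟩ := h
  refine dec_family r _ x (fun S => S.map σ.symm.toEmbedding) h1 (by simpa using h2) ?_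
  intro u v huv
  rw [← h3 _ _ (fun h => huv (σ.injective h))]
  simp [Finset.mem_map_equiv]

lemma sum3 {A B C : Type*} [Fintype A] [Fintype B] [Fintype C] (p : A → Prop) (q : B → Prop)
    (s : C → Prop) (f : A → ℝ) (g : B → ℝ) (h : C → ℝ) :
    ∑ i : A × B × C, (if p i.1 ∧ q i.2.1 ∧ s i.2.2 then f i.1 * (g i.2.1 * h i.2.2) else 0) =
      (∑ a, if p a then f a else 0) * ((∑ b, if q b then g b else 0) *
        (∑ c, if s c then h c else 0)) := by
  rw [Finset.sum_mul_sum, Finset.sum_mul_sum, Fintype.sum_prod_type]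
  apply Finset.sum_congr rfl
  intro a _
  rw [Fintype.sum_prod_type]
  simp_rw [Finset.mul_sum]
  apply Finset.sum_congr rfl
  intro b _
  apply Finset.sum_congr rfl
  intro c _
  by_cases h1 : p a <;> by_cases h2 : q b <;> by_cases h3 : s c <;> simp [h1, h2, h3]

noncomputable def gval {ι : Type*} [Fintype ι] (F : Finset ι) (k q r j : ℝ) (u v : ι × Bool) : ℝ :=
  if u.1 ∈ F then
    (if v.1 ∈ F then (if u.1 = v.1 then 0 else j * (j - 1) / (4 * (k * (k - 1))))
      else j * (r - j) / (4 * (k * q)))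
  else (if v.1 ∈ F then j * (r - j) / (4 * (k * q)) else
    (r - j) * (r - j - 1) / (2 * q * (2 * q - 1)))

lemma mul3 {x y z X Y Z : ℝ} (h1 : x = X) (h2 : y = Y) (h3 : z = Z) :
    x * (y * z) = X * (Y * Z) := by rw [h1, h2, h3]

lemma block {ι : Type*} [Fintype ι] (F : Finset ι) (r j : ℕ) (hj : j ≤ #F) (hjr : j ≤ r)
    (hR : r - j ≤ 2 * #Fᶜ) : Dec r (gval F (#F) (#Fᶜ) r j) := by
  obtain ⟨μ, μ0, μs, μ1, μu, μv⟩ := unif F j hj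
  have hcard : #(Fᶜ ×ˢ (univ : Finset Bool)) = 2 * #Fᶜ := by
    rw [card_product]; simp [mul_comm]
  obtain ⟨ρ, ρ0, ρs, ρ1, ρu, ρv⟩ := unif (Fᶜ ×ˢ (univ : Finset Bool)) (r - j) (by rw [hcard]; exact hR)
  obtain ⟨c, c0, c1, cu, cv⟩ := bits (ι := ι)
  have hcardR : (#(Fᶜ ×ˢ (univ : Finset Bool)) : ℝ) = 2 * #Fᶜ := by rw [hcard]; push_cast; ring
  rw [hcardR] at ρu ρv
  rw [Nat.cast_sub hjr] at ρu ρv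
  have hmem : ∀ w : ι × Bool, w.1 ∉ F → w ∈ Fᶜ ×ˢ (univ : Finset Bool) := by
    intro w hw; simp [hw]
  refine dec_family (I := Finset ι × (ι → Bool) × Finset (ι × Bool)) r _
    (fun i => μ i.1 * (c * ρ i.2.2))
    (fun i => univ.filter (fun u : ι × Bool =>
      if u.1 ∈ F then u.1 ∈ i.1 ∧ i.2.1 u.1 = u.2 else u ∈ i.2.2)) ?_ ?_ ?_
  · intro i
    exact mul_nonneg (μ0 _) (mul_nonneg c0 (ρ0 _))
  · rintro ⟨J, b, R⟩ h
    have hJ := μs J (left_ne_zero_of_mul h)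
    have hRR := ρs R (right_ne_zero_of_mul (right_ne_zero_of_mul h))
    have : (univ.filter (fun u : ι × Bool =>
      if u.1 ∈ F then u.1 ∈ J ∧ b u.1 = u.2 else u ∈ R)) = J.image (fun a => (a, b a)) ∪ R := by
      ext ⟨a, x⟩
      simp only [mem_filter, mem_univ, true_and, mem_union, mem_image, Prod.mk.injEq]
      split_ifs with ha
      · constructor
        · rintro ⟨h1, h2⟩; exact Or.inl ⟨a, h1, rfl, h2⟩
        · rintro (⟨a', h1, rfl, h2⟩ | h1)
          · exact ⟨h1, h2⟩
          · have := hRR.1 h1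
            simp [ha] at this
      · constructor
        · exact Or.inr
        · rintro (⟨a', h1, rfl, h2⟩ | h1)
          · exact absurd (hJ.1 h1) ha
          · exact h1
    dsimp only
    rw [this, card_union_of_disjoint, card_image_of_injective, hJ.2, hRR.2]
    · omega
    · intro a a' h; simpa using (Prod.ext_iff.1 h).1
    · rw [disjoint_left]
      intro w hw hw'
      obtain ⟨a, ha, rfl⟩ := mem_image.1 hw
      have h1 := hRR.1 hw'
      have h2 := hJ.1 ha
      simp [h2] at h1
  · have conv : ∀ (u v : ι × Bool) (p : Finset ι → Prop) (q : (ι → Bool) → Prop)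
        (s : Finset (ι × Bool) → Prop),
        (∀ J b R, ((if u.1 ∈ F then u.1 ∈ J ∧ b u.1 = u.2 else u ∈ R) ∧
          (if v.1 ∈ F then v.1 ∈ J ∧ b v.1 = v.2 else v ∈ R)) ↔ (p J ∧ q b ∧ s R)) →
        ∑ i : Finset ι × (ι → Bool) × Finset (ι × Bool),
          (if u ∈ univ.filter (fun u : ι × Bool =>
              if u.1 ∈ F then u.1 ∈ i.1 ∧ i.2.1 u.1 = u.2 else u ∈ i.2.2) ∧
              v ∈ univ.filter (fun u : ι × Bool =>
              if u.1 ∈ F then u.1 ∈ i.1 ∧ i.2.1 u.1 = u.2 else u ∈ i.2.2)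
            then μ i.1 * (c * ρ i.2.2) else 0) =
        (∑ a, if p a then μ a else 0) * ((∑ b, if q b then c else 0) *
        (∑ R, if s R then ρ R else 0)) := by
      intro u v p q s h
      rw [← sum3 p q s μ (fun _ => c) ρ]
      apply Finset.sum_congr rfl
      intro i _
      simp only [mem_filter, mem_univ, true_and]
      exact if_congr (h i.1 i.2.1 i.2.2) rfl rfl
    intro u v huv
    unfold gval
    by_cases hu : u.1 ∈ F <;> by_cases hv : v.1 ∈ F
    · simp only [hu, hv, if_true]
      by_cases huv1 : u.1 = v.1
      · rw [if_pos huv1]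
        apply Finset.sum_eq_zero
        intro i _
        rw [if_neg]
        simp only [mem_filter, mem_univ, true_and, hu, hv, if_true]
        rintro ⟨⟨_, h1⟩, _, h2⟩
        exact huv (Prod.ext huv1 (by rw [← h1, ← h2, huv1]))
      · rw [if_neg huv1]
        refine (Eq.trans (by congr!) (conv u v (fun J => u.1 ∈ J ∧ v.1 ∈ J) (fun b => b u.1 = u.2 ∧ b v.1 = v.2)
          (fun _ => True) ?_)).trans ?_
        · intro J b R
          simp only [hu, hv, if_true]
          tauto
        · simp only [if_true]
          refine (mul3 (Eq.trans (by congr!) (μv _ hu _ hv huv1)) (Eq.trans (by congr!) (cv _ u.2 _ v.2 huv1)) (Eq.trans (by congr!) (ρ1))).trans ?_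
          rw [mul_one, mul_one_div, div_div]
          congr 1; ring
    · simp only [hu, hv, if_true, if_false]
      refine (Eq.trans (by congr!) (conv u v (fun J => u.1 ∈ J) (fun b => b u.1 = u.2)
          (fun R => v ∈ R) ?_)).trans ?_
      · intro J b R
        simp only [hu, hv, if_true, if_false]
        tauto
      · refine (mul3 (Eq.trans (by congr!) (μu _ hu)) (Eq.trans (by congr!) (cu u.1 u.2)) (Eq.trans (by congr!) (ρu _ (hmem v hv)))).trans ?_
        simp only [div_eq_mul_inv, mul_inv, one_mul]
        rw [show (4 : ℝ)⁻¹ = 2⁻¹ * 2⁻¹ by norm_num]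
        ring
    · simp only [hu, hv, if_true, if_false]
      refine (Eq.trans (by congr!) (conv u v (fun J => v.1 ∈ J) (fun b => b v.1 = v.2)
          (fun R => u ∈ R) ?_)).trans ?_
      · intro J b R
        simp only [hu, hv, if_true, if_false]
        tauto
      · refine (mul3 (Eq.trans (by congr!) (μu _ hv)) (Eq.trans (by congr!) (cu v.1 v.2)) (Eq.trans (by congr!) (ρu _ (hmem u hu)))).trans ?_
        simp only [div_eq_mul_inv, mul_inv, one_mul]
        rw [show (4 : ℝ)⁻¹ = 2⁻¹ * 2⁻¹ by norm_num]
        ring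
    · simp only [hu, hv, if_false]
      refine (Eq.trans (by congr!) (conv u v (fun J => True) (fun b => True)
          (fun R => u ∈ R ∧ v ∈ R) ?_)).trans ?_
      · intro J b R
        simp only [hu, hv, if_false]
        tauto
      · simp only [if_true]
        refine (mul3 (Eq.trans (by congr!) (μ1)) (Eq.trans (by congr!) (c1)) (Eq.trans (by congr!) (ρv _ (hmem u hu) _ (hmem v hv) huv))).trans ?_
        ring

lemma block' {ι : Type*} [Fintype ι] (F : Finset ι) (r j : ℕ) (c : ℝ) (hc : 0 ≤ c)
    (h : c ≠ 0 → j ≤ #F ∧ j ≤ r ∧ r - j ≤ 2 * #Fᶜ) :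
    Dec r (fun u v => c * gval F (#F) (#Fᶜ) r j u v) := by
  by_cases h0 : c = 0
  · subst h0
    exact Dec.zero.congr (by simp)
  · obtain ⟨h1, h2, h3⟩ := h h0
    exact (block F r j h1 h2 h3).smul c hc

lemma core {ι : Type*} [Fintype ι] (r : ℕ) (hr : 3 ≤ r) (hι : Fintype.card ι = r + 1)
    (F : Finset ι) : Dec r (fun u v : ι × Bool => if u.1 = v.1 ∧ u.1 ∈ F then 0 else 1) := by
  have hkq : #F + #Fᶜ = r + 1 := by rw [card_add_card_compl, hι]
  have hrR : (3 : ℝ) ≤ r := by exact_mod_cast hr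
  have hkqR : (#F : ℝ) + #Fᶜ = r + 1 := by exact_mod_cast hkq
  have hq1 : ∀ u : ι × Bool, u.1 ∉ F → (1 : ℝ) ≤ #Fᶜ := by
    intro u hu
    have : 0 < #Fᶜ := card_pos.2 ⟨u.1, by simp [hu]⟩
    exact_mod_cast this
  have hk1 : ∀ u : ι × Bool, u.1 ∈ F → (1 : ℝ) ≤ #F := by
    intro u hu
    have : 0 < #F := card_pos.2 ⟨u.1, hu⟩
    exact_mod_cast this
  have hk2 : ∀ u v : ι × Bool, u.1 ∈ F → v.1 ∈ F → u.1 ≠ v.1 → (2 : ℝ) ≤ #F := by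
    intro u v hu hv huv
    have : 2 ≤ #F := by
      rw [← card_pair huv]; exact card_le_card (by simp [insert_subset_iff, hu, hv])
    exact_mod_cast this
  have finish : ∀ (c0 c1 c2 : ℝ) (j0 j1 j2 : ℕ),
      0 ≤ c0 → 0 ≤ c1 → 0 ≤ c2 →
      (c0 ≠ 0 → j0 ≤ #F ∧ j0 ≤ r ∧ r - j0 ≤ 2 * #Fᶜ) →
      (c1 ≠ 0 → j1 ≤ #F ∧ j1 ≤ r ∧ r - j1 ≤ 2 * #Fᶜ) →
      (c2 ≠ 0 → j2 ≤ #F ∧ j2 ≤ r ∧ r - j2 ≤ 2 * #Fᶜ) →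
      ((2 : ℝ) ≤ #F → c0 * (j0 * (j0 - 1)) + c1 * (j1 * (j1 - 1)) + c2 * (j2 * (j2 - 1)) = 4 * (#F * (#F - 1))) →
      ((1 : ℝ) ≤ #F → (1 : ℝ) ≤ #Fᶜ → c0 * (j0 * (r - j0)) + c1 * (j1 * (r - j1)) + c2 * (j2 * (r - j2)) = 4 * (#F * #Fᶜ)) →
      ((1 : ℝ) ≤ #Fᶜ → c0 * ((r - j0) * (r - j0 - 1)) + c1 * ((r - j1) * (r - j1 - 1)) + c2 * ((r - j2) * (r - j2 - 1)) = 2 * #Fᶜ * (2 * #Fᶜ - 1)) →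
      Dec r (fun u v : ι × Bool => if u.1 = v.1 ∧ u.1 ∈ F then 0 else 1) := by
    intro c0 c1 c2 j0 j1 j2 h0 h1 h2 v0 v1 v2 e1 e2 e3
    refine (((block' F r j0 c0 h0 v0).add (block' F r j1 c1 h1 v1)).add
      (block' F r j2 c2 h2 v2)).congr ?_
    intro u v huv
    unfold gval
    by_cases hu : u.1 ∈ F <;> by_cases hv : v.1 ∈ F
    · by_cases h : u.1 = v.1
      · simp [h, hv]
      · simp only [hu, hv, h, if_true, if_false, false_and]
        have := hk2 u v hu hv h
        have hne : (4 : ℝ) * (#F * (#F - 1)) ≠ 0 := by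
          refine mul_ne_zero (by norm_num) (mul_ne_zero (by linarith) (by linarith))
        rw [← mul_div_assoc, ← mul_div_assoc, ← mul_div_assoc, ← add_div, ← add_div, e1 this,
          div_self hne]
    · have hne' : u.1 ≠ v.1 := fun h => hv (h ▸ hu)
      simp only [hu, hv, hne', if_true, if_false, false_and]
      have h3 := hk1 u hu
      have h4 := hq1 v hv
      have hne : (4 : ℝ) * (#F * #Fᶜ) ≠ 0 := by positivity
      rw [← mul_div_assoc, ← mul_div_assoc, ← mul_div_assoc, ← add_div, ← add_div, e2 h3 h4,
          div_self hne]
    · have hne' : u.1 ≠ v.1 := fun h => hu (h ▸ hv)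
      simp only [hu, hv, hne', if_true, if_false, false_and]
      have h3 := hk1 v hv
      have h4 := hq1 u hu
      have hne : (4 : ℝ) * (#F * #Fᶜ) ≠ 0 := by positivity
      rw [← mul_div_assoc, ← mul_div_assoc, ← mul_div_assoc, ← add_div, ← add_div, e2 h3 h4,
          div_self hne]
    · simp only [hu, hv, if_false, and_false]
      have h4 := hq1 u hu
      have hne : (2 : ℝ) * #Fᶜ * (2 * #Fᶜ - 1) ≠ 0 := by
        refine mul_ne_zero (by positivity) (by linarith)
      rw [← mul_div_assoc, ← mul_div_assoc, ← mul_div_assoc, ← add_div, ← add_div, e3 h4,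
          div_self hne]
  generalize #F = k at *
  generalize #Fᶜ = q at *
  have hr1 : (0 : ℝ) < r - 1 := by linarith
  have hr0 : (0 : ℝ) < r := by linarith
  have hr0' := hr0.ne'
  have hr1' := hr1.ne'
  rcases le_or_gt k q with hle | hgt
  · rcases Nat.eq_zero_or_pos k with rfl | hk
    · have hq : q = r + 1 := by omega
      subst hq
      refine finish (2 * (r+1) * (2 * r + 1) / (r * (r - 1))) 0 0 0 0 0 (by positivity) le_rfl le_rfl ?_ ?_ ?_ ?_ ?_ ?_
      · intro _; omega
      · intro h; exact absurd rfl h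
      · intro h; exact absurd rfl h
      · intro h; norm_num at h
      · intro h; norm_num at h
      · intro h; push_cast; field_simp; ring
    · refine finish (4 * q / (r - 1)) (4 * k / (r - 1)) (2 * q / (r * (r - 1))) k (k - 1) 0
        (by positivity) (by positivity) (by positivity) ?_ ?_ ?_ ?_ ?_ ?_
      · intro _; omega
      · intro _; omega
      · intro _; omega
      all_goals
        have hq : (q : ℝ) = r + 1 - k := by linarith
        rw [Nat.cast_sub hk, hq]
        intros
        push_cast
        field_simp
        ring
  · obtain ⟨d, rfl⟩ : ∃ d, k = q + 1 + d := ⟨k - q - 1, by omega⟩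
    have hrq : r = 2 * q + d := by omega
    have hrqR : (r : ℝ) = 2 * q + d := by rw [hrq]; push_cast; ring
    have hq1' : (0 : ℝ) < q + 1 := by positivity
    refine finish (q * (8 * q ^ 2 + 6 * q * d + 2 * d ^ 2 + 8 * q + 4 * d) / ((q + 1) * (r * (r - 1))))
      (2 * (q + 1 + d) * (r + 2 * q) / (r * (r - 1)))
      (2 * (q + 1 + d) * (q + d) / ((q + 1) * (r * (r - 1)))) (q + 1 + d) (q + d) d
        (by positivity) (by positivity) (by positivity) ?_ ?_ ?_ ?_ ?_ ?_
    · intro h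
      have : q ≠ 0 := by rintro rfl; simp at h
      omega
    · intro _; omega
    · intro _; omega
    all_goals
      intros
      push_cast
      field_simp
      rw [hrqR]
      ring

lemma count_perm {ι : Type*} [Fintype ι] (u v : ι × Bool) (huv : u ≠ v) :
    ((#(univ.filter (fun σ : Equiv.Perm (ι × Bool) => (σ u).1 = (σ v).1)) : ℕ) : ℝ) *
      (2 * Fintype.card ι - 1) = Fintype.card (Equiv.Perm (ι × Bool)) := by
  have hsym : ∀ v', u ≠ v' → #(univ.filter (fun σ : Equiv.Perm (ι × Bool) => (σ u).1 = (σ v').1)) =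
      #(univ.filter (fun σ : Equiv.Perm (ι × Bool) => (σ u).1 = (σ v).1)) := by
    intro v' hv'
    apply Finset.card_bij' (fun σ _ => σ * Equiv.swap v v') (fun σ _ => σ * Equiv.swap v v')
    · intro σ hσ
      simpa [Equiv.swap_apply_of_ne_of_ne huv hv'] using hσ
    · intro σ hσ
      simpa [Equiv.swap_apply_of_ne_of_ne huv hv'] using hσ
    · intro σ _; simp [mul_assoc]
    · intro σ _; simp [mul_assoc]
  have h1 : ∑ v' ∈ univ.erase u, #(univ.filter (fun σ : Equiv.Perm (ι × Bool) => (σ u).1 = (σ v').1)) =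
      Fintype.card (Equiv.Perm (ι × Bool)) := by
    simp_rw [Finset.card_filter]
    rw [Finset.sum_comm]
    have : ∀ σ : Equiv.Perm (ι × Bool),
        ∑ v' ∈ univ.erase u, (if (σ u).1 = (σ v').1 then 1 else 0) = 1 := by
      intro σ
      rw [Finset.sum_eq_single (σ.symm ((σ u).1, !(σ u).2))]
      · simp
      · intro w hw hne
        rw [if_neg]
        intro h
        have hwu : w ≠ u := (mem_erase.1 hw).1
        have h2 : (σ w).2 ≠ (σ u).2 := fun h' => hwu (σ.injective (Prod.ext h.symm h'))
        apply hne
        rw [Equiv.eq_symm_apply]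
        refine Prod.ext h.symm ?_
        cases h3 : (σ w).2 <;> cases h4 : (σ u).2 <;> simp_all
      · intro h
        exfalso
        apply h
        simp only [mem_erase, mem_univ, and_true, ne_eq, Equiv.symm_apply_eq]
        intro h'
        have := congrArg Prod.snd h'
        simp at this
    simp_rw [this]
    simp
  rw [Finset.sum_congr rfl (fun v' hv' => hsym v' (Ne.symm (mem_erase.1 hv').1)), Finset.sum_const,
    card_erase_of_mem (mem_univ _), card_univ, Fintype.card_prod, Fintype.card_bool, smul_eq_mul] at h1
  rw [← h1]
  have : 0 < Fintype.card ι := Fintype.card_pos_iff.2 ⟨u.1⟩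
  rw [Nat.cast_mul, Nat.cast_sub (by omega)]
  push_cast
  ring

lemma vertex {ι : Type*} [Fintype ι] (r : ℕ) (hr : 3 ≤ r) (hι : Fintype.card ι = r + 1)
    (H : Set (Sym2 (ι × Bool))) :
    Dec r (fun u v : ι × Bool => if s(u, v) ∈ H then 1 - 1 / (2 * (r : ℝ) + 1) else 1) := by
  have hN : (0 : ℝ) < Fintype.card (Equiv.Perm (ι × Bool)) := by
    exact_mod_cast Fintype.card_pos
  have h1 : ∀ σ : Equiv.Perm (ι × Bool), Dec r (fun u v : ι × Bool =>
      1 - if (σ u).1 = (σ v).1 then (if s(u, v) ∈ H then (1 : ℝ) else 0) else 0) := by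
    intro σ
    refine ((core r hr hι (univ.filter fun a => s(σ.symm (a, false), σ.symm (a, true)) ∈ H)).equiv
      σ).congr ?_
    intro u v huv
    by_cases h : (σ u).1 = (σ v).1
    · have h2 : (σ u).2 ≠ (σ v).2 := fun h' => huv (σ.injective (Prod.ext h h'))
      have h3 : s(σ.symm ((σ u).1, false), σ.symm ((σ u).1, true)) = s(u, v) := by
        cases h4 : (σ u).2 <;> cases h5 : (σ v).2
        · simp_all
        · rw [Sym2.eq_iff]; left
          rw [Equiv.symm_apply_eq, Equiv.symm_apply_eq]
          exact ⟨Prod.ext rfl h4.symm, Prod.ext h h5.symm⟩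
        · rw [Sym2.eq_iff]; right
          rw [Equiv.symm_apply_eq, Equiv.symm_apply_eq]
          exact ⟨Prod.ext h h5.symm, Prod.ext rfl h4.symm⟩
        · simp_all
      have h6 : (σ u).1 ∈ (univ.filter fun a => s(σ.symm (a, false), σ.symm (a, true)) ∈ H) ↔
        s(u, v) ∈ H := by
        rw [mem_filter, h3]; simp
      rw [if_pos h]
      by_cases hH : s(u, v) ∈ H
      · rw [if_pos ⟨h, h6.2 hH⟩, if_pos hH]; simp
      · rw [if_neg (fun hh => hH (h6.1 hh.2)), if_neg hH]; simp
    · simp [h]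
  refine ((Dec.sum univ _ (fun σ _ => h1 σ)).smul (1 / (Fintype.card (Equiv.Perm (ι × Bool)) : ℝ))
    (by positivity)).congr ?_
  intro u v huv
  have hc := count_perm u v huv
  rw [hι] at hc
  rw [Finset.sum_sub_distrib, ← Finset.sum_filter, Finset.sum_const, Finset.sum_const, card_univ,
    nsmul_eq_mul, nsmul_eq_mul]
  have h2r : (2 * (r : ℝ) + 1) ≠ 0 := by positivity
  split_ifs
  · push_cast at hc
    have : ((#(univ.filter (fun σ : Equiv.Perm (ι × Bool) => (σ u).1 = (σ v).1)) : ℕ) : ℝ) =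
      Fintype.card (Equiv.Perm (ι × Bool)) / (2 * r + 1) := by
      rw [eq_div_iff h2r, ← hc]; ring
    rw [this]
    field_simp
  · field_simp
    ring

lemma box {ι : Type*} [Fintype ι] (r : ℕ) (hr : 3 ≤ r) (hι : Fintype.card ι = r + 1)
    (b : Sym2 (ι × Bool) → ℝ) (hb : ∀ e, b e ∈ Set.Icc (1 - 1 / (2 * (r : ℝ) + 1)) 1) :
    Dec r (fun u v : ι × Bool => b s(u, v)) := by
  have hconv : Convex ℝ {b : Sym2 (ι × Bool) → ℝ | Dec r (fun u v : ι × Bool => b s(u, v))} := by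
    intro x hx y hy a c ha hc _
    have hx' : Dec r (fun u v : ι × Bool => x s(u, v)) := hx
    have hy' : Dec r (fun u v : ι × Bool => y s(u, v)) := hy
    exact (hx'.smul a ha).add (hy'.smul c hc)
  have hsub : Set.pi Set.univ (fun _ : Sym2 (ι × Bool) => ({1 - 1 / (2 * (r : ℝ) + 1), 1} : Set ℝ)) ⊆
      {b : Sym2 (ι × Bool) → ℝ | Dec r (fun u v : ι × Bool => b s(u, v))} := by
    intro f hf
    refine (vertex r hr hι {e | f e = 1 - 1 / (2 * (r : ℝ) + 1)}).congr ?_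
    intro u v _
    have := hf s(u, v) (Set.mem_univ _)
    simp only [Set.mem_insert_iff, Set.mem_singleton_iff] at this
    simp only [Set.mem_setOf_eq]
    split_ifs with h
    · exact h.symm
    · exact (this.resolve_left h).symm
  have := convexHull_min hsub hconv
  apply this
  rw [convexHull_pi]
  intro e _
  rw [convexHull_pair, segment_eq_Icc]
  · exact hb e
  · have : (0 : ℝ) ≤ 1 / (2 * (r : ℝ) + 1) := by positivity
    linarith

lemma box_finset {V : Type*} [Fintype V] (r : ℕ) (hr : 3 ≤ r) (K : Finset V) (hK : #K = 2 * r + 2)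
    (b : V → V → ℝ) (hbs : ∀ u v, b u v = b v u)
    (hb : ∀ u ∈ K, ∀ v ∈ K, u ≠ v → b u v ∈ Set.Icc (1 - 1 / (2 * (r : ℝ) + 1)) 1) :
    ∃ x : Finset V → ℝ, (∀ S, 0 ≤ x S) ∧ (∀ S, x S ≠ 0 → S ⊆ K ∧ #S = r) ∧
    ∀ u ∈ K, ∀ v ∈ K, u ≠ v → ∑ S, (if u ∈ S ∧ v ∈ S then x S else 0) = b u v := by
  have hcard : Fintype.card K = Fintype.card (Fin (r+1) × Bool) := by
    simp [hK]; ring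
  let σ : K ≃ Fin (r+1) × Bool := Fintype.equivOfCardEq hcard
  have h1 := box (ι := Fin (r+1)) r hr (by simp)
    (fun e => if e.IsDiag then 1 else
      Sym2.lift ⟨fun u v : Fin (r+1) × Bool => b (σ.symm u) (σ.symm v), fun u v => hbs _ _⟩ e) (by
    intro e
    induction e using Sym2.ind with
    | _ u v =>
      split_ifs with h
      · have : (0 : ℝ) ≤ 1 / (2 * (r : ℝ) + 1) := by positivity
        exact ⟨by linarith, le_rfl⟩
      · rw [Sym2.lift_mk]
        apply hb _ (σ.symm u).2 _ (σ.symm v).2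
        intro h'
        apply h
        rw [Sym2.mk_isDiag_iff]
        exact σ.symm.injective (Subtype.ext h'))
  obtain ⟨x, x0, xs, xe⟩ := h1.equiv σ
  refine ⟨fun S => ∑ T : Finset K, if T.map (Function.Embedding.subtype _) = S then x T else 0, ?_, ?_, ?_⟩
  · intro S
    exact Finset.sum_nonneg fun T _ => by split_ifs; exacts [x0 T, le_rfl]
  · intro S hS
    obtain ⟨T, _, hT⟩ := Finset.exists_ne_zero_of_sum_ne_zero hS
    by_cases h' : T.map (Function.Embedding.subtype _) = S
    · rw [if_pos h'] at hT
      subst h'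
      refine ⟨?_, by rw [card_map]; exact xs T hT⟩
      intro w hw
      obtain ⟨w', _, rfl⟩ := mem_map.1 hw
      exact w'.2
    · rw [if_neg h'] at hT; exact absurd rfl hT
  · intro u hu v hv huv
    have h2 := xe ⟨u, hu⟩ ⟨v, hv⟩ (by simpa using huv)
    have h3 : ¬ (s(σ ⟨u, hu⟩, σ ⟨v, hv⟩)).IsDiag := by
      rw [Sym2.mk_isDiag_iff]; simpa using huv
    dsimp only at h2
    rw [if_neg h3, Sym2.lift_mk] at h2
    simp only [Equiv.symm_apply_apply] at h2
    rw [← h2]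
    simp_rw [← Finset.sum_filter (fun S : Finset V => u ∈ S ∧ v ∈ S)]
    rw [Finset.sum_comm]
    apply Finset.sum_congr rfl
    intro T _
    rw [Finset.sum_ite_eq]
    simp [hu, hv]

theorem stmt5 {V : Type*} [Fintype V] (G : SimpleGraph V) (r : ℕ) (hr : 3 ≤ r)
    (w : Finset V → ℝ) (hw : ∀ s, 0 ≤ w s)
    (hlow : ∀ u v : V, G.Adj u v →
      1 - 1 / (2 * (r : ℝ) + 1) ≤
        ∑ s ∈ univ.filter (fun s : Finset V => G.IsNClique (2 * r + 2) s ∧ u ∈ s ∧ v ∈ s), w s)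
    (hhigh : ∀ u v : V, G.Adj u v →
      ∑ s ∈ univ.filter (fun s : Finset V => G.IsNClique (2 * r + 2) s ∧ u ∈ s ∧ v ∈ s), w s ≤ 1) :
    fracCliqueDecomp G r := by
  obtain ⟨c, hc⟩ : ∃ c : V → V → ℝ, c = fun u v =>
    ∑ s ∈ univ.filter (fun s : Finset V => G.IsNClique (2 * r + 2) s ∧ u ∈ s ∧ v ∈ s), w s := ⟨_, rfl⟩
  have hcs : ∀ u v, c u v = c v u := by
    intro u v
    rw [hc]
    dsimp only
    congr 1
    ext s
    simp only [mem_filter, mem_univ, true_and]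
    tauto
  have hlow' : ∀ u v, G.Adj u v → 1 - 1 / (2 * (r : ℝ) + 1) ≤ c u v := by
    intro u v h; rw [hc]; exact hlow u v h
  have hhigh' : ∀ u v, G.Adj u v → c u v ≤ 1 := by
    intro u v h; rw [hc]; exact hhigh u v h
  have hrR : (3 : ℝ) ≤ r := by exact_mod_cast hr
  have hL : 1 - 1 / (2 * (r : ℝ) + 1) = 2 * r / (2 * r + 1) := by field_simp; ring
  have hLpos : 0 < 1 - 1 / (2 * (r : ℝ) + 1) := by rw [hL]; positivity
  have hex : ∀ K : Finset V, ∃ x : Finset V → ℝ, G.IsNClique (2 * r + 2) K →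
      (∀ S, 0 ≤ x S) ∧ (∀ S, x S ≠ 0 → S ⊆ K ∧ #S = r) ∧
      ∀ u ∈ K, ∀ v ∈ K, u ≠ v → ∑ S, (if u ∈ S ∧ v ∈ S then x S else 0) =
        (1 - 1 / (2 * (r : ℝ) + 1)) / c u v := by
    intro K
    by_cases hK : G.IsNClique (2 * r + 2) K
    · obtain ⟨x, hx⟩ := box_finset r hr K hK.card_eq (fun u v => (1 - 1 / (2 * (r : ℝ) + 1)) / c u v)
        (fun u v => by rw [hcs]) (by
          intro u hu v hv huv
          have hadj := hK.isClique hu hv huv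
          have h1 := hlow' u v hadj
          have h2 := hhigh' u v hadj
          have h3 : 0 < c u v := by linarith
          constructor
          · rw [le_div_iff₀ h3]
            nlinarith
          · rw [div_le_one h3]; exact h1)
      exact ⟨x, fun _ => hx⟩
    · exact ⟨0, fun h => absurd h hK⟩
  choose x hx using hex
  refine ⟨fun S => ∑ K ∈ univ.filter (fun K : Finset V => G.IsNClique (2 * r + 2) K),
    w K * ((1 - 1 / (2 * (r : ℝ) + 1))⁻¹ * x K S), ?_, ?_⟩
  · intro S
    apply Finset.sum_nonneg
    intro K hK
    exact mul_nonneg (hw K) (mul_nonneg (inv_nonneg.2 hLpos.le) ((hx K (mem_filter.1 hK).2).1 S))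
  · intro u v huv
    have h3 : 0 < c u v := lt_of_lt_of_le hLpos (hlow' u v huv)
    rw [Finset.sum_comm]
    have key : ∀ K ∈ univ.filter (fun K : Finset V => G.IsNClique (2 * r + 2) K),
        ∑ S ∈ univ.filter (fun s : Finset V => G.IsNClique r s ∧ u ∈ s ∧ v ∈ s),
          w K * ((1 - 1 / (2 * (r : ℝ) + 1))⁻¹ * x K S) =
        if u ∈ K ∧ v ∈ K then w K / c u v else 0 := by
      intro K hK
      have hK' := (mem_filter.1 hK).2
      obtain ⟨x0, xs, xe⟩ := hx K hK'
      have e1 : ∑ S ∈ univ.filter (fun s : Finset V => G.IsNClique r s ∧ u ∈ s ∧ v ∈ s), x K S =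
          ∑ S, (if u ∈ S ∧ v ∈ S then x K S else 0) := by
        rw [Finset.sum_filter]
        apply Finset.sum_congr rfl
        intro S _
        by_cases h0 : x K S = 0
        · simp [h0]
        · obtain ⟨hS1, hS2⟩ := xs S h0
          have : G.IsNClique r S := ⟨hK'.isClique.subset (by exact_mod_cast hS1), hS2⟩
          simp [this]
      rw [← Finset.mul_sum, ← Finset.mul_sum, e1]
      split_ifs with h
      · rw [xe u h.1 v h.2 huv.ne, ← mul_div_assoc, inv_mul_cancel₀ hLpos.ne', mul_one_div]
      · rw [Finset.sum_eq_zero, mul_zero, mul_zero]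
        intro S _
        split_ifs with h'
        · by_contra h0
          exact h ⟨(xs S h0).1 h'.1, (xs S h0).1 h'.2⟩
        · rfl
    rw [Finset.sum_congr rfl key, ← Finset.sum_filter, Finset.filter_filter, ← Finset.sum_div]
    have : c u v = ∑ s ∈ univ.filter (fun s : Finset V => G.IsNClique (2 * r + 2) s ∧ u ∈ s ∧ v ∈ s), w s := by
      rw [hc]
    rw [← this, div_self h3.ne']
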